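/- arXiv:2201.04973 — 3 statements merged into one kernel-verified Lean document; each statement's English description precedes it below -/
import Mathlib

section
/- In the unknown-coins game starting from N ≥ 2 unknown coins together with one extra coin known by everyone to be genuine, the positions reachable in one legal weighing are exactly the following: (a) for each m with 1 ≤ m ≤ N−1, the position with m unknown coins (the counterfeit among them) and the other N−m coins excluded; and (b) for each m with 1 ≤ m ≤ N, the position with m destined coins (the counterfeit among them) and the other N−m coins excluded. There are no other reachable positions. -/
/-!
A model of the counterfeit-coin weighing games.

There are `n` coins, indexed by `Fin n`, exactly one of which is counterfeit;
all genuine coins weigh the same, and the counterfeit is lighter or heavier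
than a genuine coin according to its `FakeType`.  Each coin carries a
`CoinStatus` recording the Observer's knowledge about it:

* `excluded`: the Observer knows the coin is genuine;
* `light`   : destined to be lighter (if this coin is the counterfeit, it is lighter);
* `heavy`   : destined to be heavier (if this coin is the counterfeit, it is heavier);
* `unknown` : the coin could be the counterfeit, either lighter or heavier.

Both players know the counterfeit coin and its type, and alternately perform
weighings: two disjoint sets of coins of equal size are put on the two pans of a
balance scale, and the outcome is determined by the truth.  After a balanced
weighing, the coins on the scale become excluded.  After an unbalanced weighing,
the coins off the scale become excluded; a coin on the lighter pan becomes
light-destined unless this contradicts its previous status (a heavy-destined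
coin on the lighter pan becomes excluded); symmetrically for the heavier pan;
excluded coins stay excluded.  A weighing is legal iff the Observer gains some
new information, i.e. some coin changes status.

`Found P` says the Observer has found the counterfeit coin (exactly one coin is
not excluded); `FoundAndIdentified P` says she has moreover identified it as
lighter or heavier.  In the game whose end condition is a goal `goal`, play
stops as soon as the goal is reached (`GMove goal`).  `NormalWin` is the
normal-play winning predicate for the player to move (the player unable to move
loses, so the player making the last legal weighing wins); `MisereWin` is the
misère-play winning predicate (the player whose weighing reveals the full
information, i.e. moves to a goal position, loses); `grundy` is the Grundy
(nim-)value: the `mex` of the Grundy values of the options, a position without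
options having Grundy value `0`.  Since every legal weighing strictly decreases
the total hidden information `info P`, defining these by recursion with fuel
`info P` gives the correct values.
-/

/-- The Observer's knowledge about one coin. -/
inductive CoinStatus : Type
  | excluded : CoinStatus
  | light    : CoinStatus
  | heavy    : CoinStatus
  | unknown  : CoinStatus
  deriving DecidableEq

/-- Whether the counterfeit coin is actually lighter or heavier than a genuine coin. -/
inductive FakeType : Type
  | light : FakeType
  | heavy : FakeType
  deriving DecidableEq

/-- The destiny status corresponding to the true type of the counterfeit coin. -/
def FakeType.destiny : FakeType → CoinStatus
  | FakeType.light => CoinStatus.light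
  | FakeType.heavy => CoinStatus.heavy

/-- A position of the game: the statuses of the coins (the Observer's knowledge)
together with the identity and the true type of the counterfeit coin (which both
players know). -/
structure Position (n : ℕ) : Type where
  status : Fin n → CoinStatus
  counterfeit : Fin n
  fakeType : FakeType

/-- Possible outcomes of a weighing. -/
inductive Outcome : Type
  | balanced | leftLighter | rightLighter
  deriving DecidableEq

/-- The truthful outcome of weighing pan `A` (left) against pan `B` (right):
it is determined by the location and the type of the counterfeit coin. -/
def outcome {n : ℕ} (P : Position n) (A B : Finset (Fin n)) : Outcome :=
  if P.counterfeit ∈ A then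
    (match P.fakeType with
      | FakeType.light => Outcome.leftLighter
      | FakeType.heavy => Outcome.rightLighter)
  else if P.counterfeit ∈ B then
    (match P.fakeType with
      | FakeType.light => Outcome.rightLighter
      | FakeType.heavy => Outcome.leftLighter)
  else Outcome.balanced

/-- New status of a coin that lay on the lighter pan of an unbalanced weighing. -/
def onLighterPan : CoinStatus → CoinStatus
  | CoinStatus.excluded => CoinStatus.excluded
  | CoinStatus.heavy => CoinStatus.excluded
  | _ => CoinStatus.light

/-- New status of a coin that lay on the heavier pan of an unbalanced weighing. -/
def onHeavierPan : CoinStatus → CoinStatus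
  | CoinStatus.excluded => CoinStatus.excluded
  | CoinStatus.light => CoinStatus.excluded
  | _ => CoinStatus.heavy

/-- The statuses after weighing `A` against `B`. -/
def updateStatus {n : ℕ} (P : Position n) (A B : Finset (Fin n)) (i : Fin n) :
    CoinStatus :=
  match outcome P A B with
  | Outcome.balanced =>
      if i ∈ A ∨ i ∈ B then CoinStatus.excluded else P.status i
  | Outcome.leftLighter =>
      if i ∈ A then onLighterPan (P.status i)
      else if i ∈ B then onHeavierPan (P.status i)
      else CoinStatus.excluded
  | Outcome.rightLighter =>
      if i ∈ B then onLighterPan (P.status i)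
      else if i ∈ A then onHeavierPan (P.status i)
      else CoinStatus.excluded

/-- The position obtained from `P` by weighing pan `A` against pan `B`. -/
def weigh {n : ℕ} (P : Position n) (A B : Finset (Fin n)) : Position n :=
  ⟨updateStatus P A B, P.counterfeit, P.fakeType⟩

/-- `Move P Q`: `Q` is obtained from `P` by one legal weighing, i.e. the two
pans are disjoint and carry equally many coins, and the Observer gains some new
information (some coin changes status). -/
def Move {n : ℕ} (P Q : Position n) : Prop :=
  ∃ A B : Finset (Fin n), Disjoint A B ∧ A.card = B.card ∧
    updateStatus P A B ≠ P.status ∧ Q = weigh P A B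

/-- The set of coins currently having status `s`. -/
def statusSet {n : ℕ} (P : Position n) (s : CoinStatus) : Finset (Fin n) :=
  Finset.univ.filter fun i => P.status i = s

/-- The set of coins not yet known to be genuine. -/
def nonExcluded {n : ℕ} (P : Position n) : Finset (Fin n) :=
  Finset.univ.filter fun i => P.status i ≠ CoinStatus.excluded

/-- The number of unknown coins. -/
def unknownCount {n : ℕ} (P : Position n) : ℕ :=
  (statusSet P CoinStatus.unknown).card

/-- The number of destined coins. -/
def destinedCount {n : ℕ} (P : Position n) : ℕ :=
  (statusSet P CoinStatus.light).card + (statusSet P CoinStatus.heavy).card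

/-- The number of coins sharing the counterfeit coin's status, counting the
counterfeit coin itself. -/
def sameDestinyCount {n : ℕ} (P : Position n) : ℕ :=
  (Finset.univ.filter fun i => P.status i = P.status P.counterfeit).card

/-- The Observer has found the counterfeit coin: exactly one coin is not excluded. -/
def Found {n : ℕ} (P : Position n) : Prop := (nonExcluded P).card = 1

/-- The Observer has found the counterfeit coin and knows whether it is lighter
or heavier. -/
def FoundAndIdentified {n : ℕ} (P : Position n) : Prop :=
  Found P ∧ P.status P.counterfeit ≠ CoinStatus.unknown

/-- Moves in the game whose end condition is `goal`: the game stops as soon as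
the Observer's goal is reached, so no further weighings happen after that. -/
def GMove {n : ℕ} (goal : Position n → Prop) (P Q : Position n) : Prop :=
  ¬ goal P ∧ Move P Q

/-- The amount of information about one coin still hidden from the Observer. -/
def statusWeight : CoinStatus → ℕ
  | CoinStatus.excluded => 0
  | CoinStatus.unknown => 2
  | _ => 1

/-- The total information still hidden from the Observer.  Every legal weighing
strictly decreases it, so it bounds the number of remaining moves. -/
def info {n : ℕ} (P : Position n) : ℕ := ∑ i, statusWeight (P.status i)

/-- Normal-play winning predicate, computed with fuel. -/
def NormalWinAux {n : ℕ} (moveRel : Position n → Position n → Prop) :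
    ℕ → Position n → Prop
  | 0, _ => False
  | k + 1, P => ∃ Q, moveRel P Q ∧ ¬ NormalWinAux moveRel k Q

/-- The player to move wins under normal play: a player who has no legal move
loses (so the player making the last legal weighing wins).  The fuel `info P`
suffices since every legal weighing strictly decreases `info`. -/
def NormalWin {n : ℕ} (moveRel : Position n → Position n → Prop)
    (P : Position n) : Prop :=
  NormalWinAux moveRel (info P) P

/-- Misère-play winning predicate, computed with fuel. -/
def MisereWinAux {n : ℕ} (moveRel : Position n → Position n → Prop)
    (goal : Position n → Prop) : ℕ → Position n → Prop
  | 0, P => goal P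
  | k + 1, P => goal P ∨ ∃ Q, moveRel P Q ∧ ¬ MisereWinAux moveRel goal k Q

/-- The player to move wins under misère play: the player whose weighing
reveals the full information to the Observer (i.e. moves to a position
satisfying `goal`) loses; equivalently, the player to move at a goal position
has already won.  A position is a P-position iff `MisereWin` fails there. -/
def MisereWin {n : ℕ} (moveRel : Position n → Position n → Prop)
    (goal : Position n → Prop) (P : Position n) : Prop :=
  MisereWinAux moveRel goal (info P) P

/-- Minimum excludant of a set of naturals. -/
noncomputable def mex (s : Set ℕ) : ℕ := sInf {k : ℕ | k ∉ s}

/-- Grundy values, computed with fuel. -/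
noncomputable def grundyAux {n : ℕ} (moveRel : Position n → Position n → Prop) :
    ℕ → Position n → ℕ
  | 0, _ => 0
  | k + 1, P => mex {g : ℕ | ∃ Q, moveRel P Q ∧ grundyAux moveRel k Q = g}

/-- The Grundy (nim-)value of a position: the `mex` of the Grundy values of the
positions reachable in one legal move; a position with no legal move has Grundy
value `0`.  The fuel `info P` suffices since every legal weighing strictly
decreases `info`. -/
noncomputable def grundy {n : ℕ} (moveRel : Position n → Position n → Prop)
    (P : Position n) : ℕ :=
  grundyAux moveRel (info P) P

theorem Finset.exists_disjoint_union_eq_of_even_card {α : Type*} [DecidableEq α] {S : Finset α}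
    (hS : Even S.card) : ∃ A B : Finset α, Disjoint A B ∧ A.card = B.card ∧ A ∪ B = S := by
  obtain ⟨k, hk⟩ := hS
  obtain ⟨A, hA, hcard⟩ := Finset.exists_subset_card_eq (s := S) (n := k) (by omega)
  refine ⟨A, S \ A, Finset.disjoint_sdiff, ?_, Finset.union_sdiff_of_subset hA⟩
  rw [Finset.card_sdiff_of_subset hA]
  omega

/-- With a genuine coin `e` at hand, any set of other coins can be put on the scale. -/
theorem Finset.exists_pans {α : Type*} [DecidableEq α] {T : Finset α} {e : α} (he : e ∉ T) :
    ∃ A B : Finset α, Disjoint A B ∧ A.card = B.card ∧ ∀ i, i ≠ e → (i ∈ A ∪ B ↔ i ∈ T) := by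
  rcases Nat.even_or_odd T.card with hT | hT
  · obtain ⟨A, B, hd, hc, hU⟩ := Finset.exists_disjoint_union_eq_of_even_card hT
    exact ⟨A, B, hd, hc, fun i _ => by rw [hU]⟩
  · have hT' : Even (insert e T).card := by
      rw [Finset.card_insert_of_notMem he]
      exact hT.add_one
    obtain ⟨A, B, hd, hc, hU⟩ := Finset.exists_disjoint_union_eq_of_even_card hT'
    exact ⟨A, B, hd, hc, fun i hi => by simp [hU, hi]⟩

theorem destinedCount_eq_card_filter {n : ℕ} (P : Position n) :
    destinedCount P = (Finset.univ.filter fun i =>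
      P.status i = CoinStatus.light ∨ P.status i = CoinStatus.heavy).card := by
  rw [Finset.filter_or, Finset.card_union_of_disjoint]
  · rfl
  · refine Finset.disjoint_filter.2 fun i _ h => ?_
    simp [h]

section UnknownCoins

variable {n : ℕ} {P : Position n} {A B : Finset (Fin n)}

theorem updateStatus_of_notMem (h : P.counterfeit ∉ A ∪ B) (i : Fin n) :
    updateStatus P A B i = if i ∈ A ∪ B then CoinStatus.excluded else P.status i := by
  simp only [Finset.mem_union, not_or] at h
  simp [updateStatus, outcome, h]

theorem updateStatus_of_mem (h : P.counterfeit ∈ A ∪ B)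
    (hall : ∀ i, P.status i = CoinStatus.unknown ∨ P.status i = CoinStatus.excluded) (i : Fin n) :
    updateStatus P A B i ≠ CoinStatus.unknown ∧
      ((updateStatus P A B i = CoinStatus.light ∨ updateStatus P A B i = CoinStatus.heavy) ↔
        P.status i = CoinStatus.unknown ∧ i ∈ A ∪ B) := by
  simp only [Finset.mem_union] at h ⊢
  unfold updateStatus outcome
  rcases hall i with hi | hi <;> cases P.fakeType <;> by_cases hA : P.counterfeit ∈ A <;>
    by_cases hiA : i ∈ A <;> by_cases hiB : i ∈ B <;>
    simp_all [onLighterPan, onHeavierPan]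

theorem unknownCount_weigh_of_notMem (h : P.counterfeit ∉ A ∪ B) :
    unknownCount (weigh P A B) = (statusSet P CoinStatus.unknown \ (A ∪ B)).card := by
  unfold unknownCount
  congr 1
  ext i
  simp only [statusSet, weigh, updateStatus_of_notMem h, Finset.mem_filter, Finset.mem_univ,
    Finset.mem_sdiff, true_and]
  split_ifs with hi <;> simp [hi]

theorem destinedCount_weigh_of_notMem (h : P.counterfeit ∉ A ∪ B)
    (hall : ∀ i, P.status i = CoinStatus.unknown ∨ P.status i = CoinStatus.excluded) :
    destinedCount (weigh P A B) = 0 := by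
  rw [destinedCount_eq_card_filter, Finset.card_eq_zero]
  refine Finset.filter_eq_empty_iff.2 fun i _ => ?_
  simp only [weigh, updateStatus_of_notMem h]
  split_ifs
  · simp
  · rcases hall i with hi | hi <;> simp [hi]

theorem unknownCount_weigh_of_mem (h : P.counterfeit ∈ A ∪ B)
    (hall : ∀ i, P.status i = CoinStatus.unknown ∨ P.status i = CoinStatus.excluded) :
    unknownCount (weigh P A B) = 0 :=
  Finset.card_eq_zero.2 <| Finset.filter_eq_empty_iff.2 fun i _ =>
    (updateStatus_of_mem h hall i).1

theorem destinedCount_weigh_of_mem (h : P.counterfeit ∈ A ∪ B)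
    (hall : ∀ i, P.status i = CoinStatus.unknown ∨ P.status i = CoinStatus.excluded) :
    destinedCount (weigh P A B) = (statusSet P CoinStatus.unknown ∩ (A ∪ B)).card := by
  rw [destinedCount_eq_card_filter]
  congr 1
  ext i
  rw [Finset.mem_filter, Finset.mem_inter, statusSet, Finset.mem_filter]
  simpa [weigh] using (updateStatus_of_mem h hall i).2

end UnknownCoins

/-- In the unknown-coins game starting from `N ≥ 2` unknown
coins together with one extra coin known to be genuine, the positions reachable
in one legal weighing are exactly: (a) for each `m` with `1 ≤ m ≤ N-1`, the
position with `m` unknown coins (the counterfeit among them), no destined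
coins, and the other coins excluded; and (b) for each `m` with `1 ≤ m ≤ N`,
the position with `m` destined coins (the counterfeit among them), no unknown
coins, and the other coins excluded.  There are no other reachable positions. -/
theorem unknown_extra_first_moves {n N : ℕ} (P : Position n) (hN : 2 ≤ N)
    (hu : unknownCount P = N)
    (he : (statusSet P CoinStatus.excluded).card = 1)
    (hall : ∀ i, P.status i = CoinStatus.unknown ∨ P.status i = CoinStatus.excluded)
    (hcf : P.status P.counterfeit = CoinStatus.unknown) :
    (∀ Q, Move P Q →
      ((1 ≤ unknownCount Q ∧ unknownCount Q ≤ N - 1 ∧ destinedCount Q = 0 ∧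
          Q.status Q.counterfeit = CoinStatus.unknown) ∨
       (1 ≤ destinedCount Q ∧ destinedCount Q ≤ N ∧ unknownCount Q = 0 ∧
          (Q.status Q.counterfeit = CoinStatus.light ∨
            Q.status Q.counterfeit = CoinStatus.heavy)))) ∧
    (∀ m, 1 ≤ m → m ≤ N - 1 →
      ∃ Q, Move P Q ∧ unknownCount Q = m ∧ destinedCount Q = 0 ∧
        Q.status Q.counterfeit = CoinStatus.unknown) ∧
    (∀ m, 1 ≤ m → m ≤ N →
      ∃ Q, Move P Q ∧ destinedCount Q = m ∧ unknownCount Q = 0 ∧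
        (Q.status Q.counterfeit = CoinStatus.light ∨
          Q.status Q.counterfeit = CoinStatus.heavy)) := by
  have hcU : P.counterfeit ∈ statusSet P CoinStatus.unknown := by simp [statusSet, hcf]
  obtain ⟨e, he⟩ := Finset.card_pos.1 (he ▸ Nat.one_pos)
  have heU : e ∉ statusSet P CoinStatus.unknown := by
    simp only [statusSet, Finset.mem_filter, Finset.mem_univ, true_and] at he ⊢
    simp [he]
  have pans : ∀ T ⊆ statusSet P CoinStatus.unknown, ∃ A B : Finset (Fin n), Disjoint A B ∧
      A.card = B.card ∧ ∀ i ∈ statusSet P CoinStatus.unknown, (i ∈ A ∪ B ↔ i ∈ T) := by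
    intro T hT
    obtain ⟨A, B, hd, hc, hAB⟩ := Finset.exists_pans fun h => heU (hT h)
    exact ⟨A, B, hd, hc, fun i hi => hAB i fun hie => heU (hie ▸ hi)⟩
  refine ⟨?_, fun m hm hmN => ?_, fun m hm hmN => ?_⟩
  · rintro Q ⟨A, B, -, -, hne, rfl⟩
    by_cases h : P.counterfeit ∈ A ∪ B
    · right
      refine ⟨?_, ?_, unknownCount_weigh_of_mem h hall,
        (updateStatus_of_mem h hall _).2.2 ⟨hcf, h⟩⟩
      · rw [destinedCount_weigh_of_mem h hall]
        exact Finset.card_pos.2 ⟨_, Finset.mem_inter.2 ⟨hcU, h⟩⟩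
      · rw [destinedCount_weigh_of_mem h hall, ← hu]
        exact Finset.card_le_card Finset.inter_subset_left
    · left
      refine ⟨?_, ?_, destinedCount_weigh_of_notMem h hall, ?_⟩
      · rw [unknownCount_weigh_of_notMem h]
        exact Finset.card_pos.2 ⟨_, Finset.mem_sdiff.2 ⟨hcU, h⟩⟩
      · rw [unknownCount_weigh_of_notMem h, ← hu]
        refine Nat.le_sub_one_of_lt (Finset.card_lt_card ?_)
        refine Finset.ssubset_iff_subset_ne.2 ⟨Finset.sdiff_subset, fun heq => hne ?_⟩
        rw [Finset.sdiff_eq_self_iff_disjoint] at heq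
        funext i
        rw [updateStatus_of_notMem h]
        split_ifs with hi
        · refine ((hall i).resolve_left fun hiu => ?_).symm
          exact Finset.disjoint_left.1 heq (by simp [statusSet, hiu]) hi
        · rfl
      · exact (updateStatus_of_notMem h _).trans ((if_neg h).trans hcf)
  · obtain ⟨S, hcS, hSU, hS⟩ := Finset.exists_subsuperset_card_eq
      (Finset.singleton_subset_iff.2 hcU) (by simpa using hm)
      (show m ≤ (statusSet P CoinStatus.unknown).card by unfold unknownCount at hu; omega)
    rw [Finset.singleton_subset_iff] at hcS
    obtain ⟨A, B, hd, hc, hAB⟩ := pans (statusSet P CoinStatus.unknown \ S) Finset.sdiff_subset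
    have h : P.counterfeit ∉ A ∪ B := by simp [hAB _ hcU, hcS]
    have hcount : unknownCount (weigh P A B) = m := by
      rw [unknownCount_weigh_of_notMem h, ← hS]
      congr 1
      ext i
      grind
    refine ⟨weigh P A B, ⟨A, B, hd, hc, fun heq => ?_, rfl⟩, hcount,
      destinedCount_weigh_of_notMem h hall, ?_⟩
    · have : unknownCount (weigh P A B) = unknownCount P := by
        simp only [unknownCount, statusSet, weigh, heq]
      omega
    · exact (updateStatus_of_notMem h _).trans ((if_neg h).trans hcf)
  · obtain ⟨S, hcS, hSU, hS⟩ := Finset.exists_subsuperset_card_eq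
      (Finset.singleton_subset_iff.2 hcU) (by simpa using hm)
      (show m ≤ (statusSet P CoinStatus.unknown).card by unfold unknownCount at hu; omega)
    rw [Finset.singleton_subset_iff] at hcS
    obtain ⟨A, B, hd, hc, hAB⟩ := pans S hSU
    have h : P.counterfeit ∈ A ∪ B := (hAB _ hcU).2 hcS
    refine ⟨weigh P A B, ⟨A, B, hd, hc, fun heq => ?_, rfl⟩, ?_,
      unknownCount_weigh_of_mem h hall, (updateStatus_of_mem h hall _).2.2 ⟨hcf, h⟩⟩
    · exact (updateStatus_of_mem h hall P.counterfeit).1 (by rw [heq, hcf])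
    · rw [destinedCount_weigh_of_mem h hall, ← hS]
      congr 1
      ext i
      grind
end

section
/- For every N ≥ 2, in the misère-play unknown-coins games with one extra genuine coin, FM^+_N and FIM^+_N, the first player wins: weighing the counterfeit coin against one other unknown coin is a legal weighing leaving exactly two non-excluded coins of opposite destinies (plus known-genuine coins), a position from which every legal weighing of the opponent completes the Observer's goal, so the opponent loses. -/
theorem mem_nonExcluded {n : ℕ} {P : Position n} {i : Fin n} :
    i ∈ nonExcluded P ↔ P.status i ≠ CoinStatus.excluded := by
  simp [nonExcluded]

theorem misereWinAux_of_goal {n : ℕ} {moveRel : Position n → Position n → Prop}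
    {goal : Position n → Prop} {P : Position n} (h : goal P) (k : ℕ) :
    MisereWinAux moveRel goal k P := by
  cases k with
  | zero => exact h
  | succ k => exact Or.inl h

theorem not_misereWinAux_of_forall_move_goal {n : ℕ}
    {moveRel : Position n → Position n → Prop} {goal : Position n → Prop} {Q : Position n}
    (hQ : ¬ goal Q) (hmove : ∀ R, moveRel Q R → goal R) (k : ℕ) :
    ¬ MisereWinAux moveRel goal k Q := by
  cases k with
  | zero => exact hQ
  | succ k =>
    rintro (h | ⟨R, hR, hlose⟩)
    · exact hQ h
    · exact hlose (misereWinAux_of_goal (hmove R hR) k)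

theorem info_pos {n : ℕ} {P : Position n} {i : Fin n} (h : P.status i ≠ CoinStatus.excluded) :
    0 < info P := by
  refine Finset.sum_pos' (fun _ _ => Nat.zero_le _) ⟨i, Finset.mem_univ i, ?_⟩
  cases hi : P.status i <;> simp_all [statusWeight]

/-- Moving to a position all of whose options reach the goal wins the misère game. -/
theorem misereWin_of_move {n : ℕ} {goal : Position n → Prop} {P Q : Position n}
    {i : Fin n} (hi : P.status i ≠ CoinStatus.excluded) (hPQ : GMove goal P Q)
    (hQ : ¬ goal Q) (hmove : ∀ R, GMove goal Q R → goal R) :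
    MisereWin (GMove goal) goal P := by
  obtain ⟨k, hk⟩ := Nat.exists_eq_succ_of_ne_zero (info_pos hi).ne'
  unfold MisereWin
  rw [hk]
  exact Or.inr ⟨Q, hPQ, not_misereWinAux_of_forall_move_goal hQ hmove k⟩

theorem updateStatus_eq_or_excluded {n : ℕ} (P : Position n) (A B : Finset (Fin n))
    {i : Fin n} (h : P.status i ≠ CoinStatus.unknown) :
    updateStatus P A B i = P.status i ∨ updateStatus P A B i = CoinStatus.excluded := by
  unfold updateStatus
  cases hi : P.status i <;> cases outcome P A B <;> dsimp only <;> split_ifs <;>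
    simp_all [onLighterPan, onHeavierPan]

theorem updateStatus_counterfeit {n : ℕ} (P : Position n) {A B : Finset (Fin n)}
    (hAB : Disjoint A B) (h : P.status P.counterfeit = P.fakeType.destiny) :
    updateStatus P A B P.counterfeit = P.fakeType.destiny := by
  have hd : P.counterfeit ∈ A → P.counterfeit ∉ B := fun hA => Finset.disjoint_left.mp hAB hA
  cases hf : P.fakeType <;> by_cases hA : P.counterfeit ∈ A <;>
    by_cases hB : P.counterfeit ∈ B <;>
    simp_all [updateStatus, outcome, FakeType.destiny, onLighterPan, onHeavierPan]

theorem FakeType.destiny_ne_excluded (t : FakeType) : t.destiny ≠ CoinStatus.excluded := by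
  cases t <;> simp [FakeType.destiny]

theorem FakeType.destiny_ne_unknown (t : FakeType) : t.destiny ≠ CoinStatus.unknown := by
  cases t <;> simp [FakeType.destiny]

/-- If the counterfeit coin is destined and at most one other coin, itself not unknown,
remains in question, then every legal weighing finds and identifies the counterfeit coin. -/
theorem foundAndIdentified_of_move {n : ℕ} {Q R : Position n} {j : Fin n}
    (hc : Q.status Q.counterfeit = Q.fakeType.destiny)
    (hj : Q.status j ≠ CoinStatus.unknown)
    (hother : ∀ i, i ≠ Q.counterfeit → i ≠ j → Q.status i = CoinStatus.excluded)
    (hQR : Move Q R) : FoundAndIdentified R := by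
  obtain ⟨A, B, hAB, -, hne, rfl⟩ := hQR
  have hc' := updateStatus_counterfeit Q hAB hc
  have hother' : ∀ i, i ≠ Q.counterfeit → i ≠ j →
      updateStatus Q A B i = CoinStatus.excluded := fun i hi hij => by
    have hex := hother i hi hij
    rcases updateStatus_eq_or_excluded Q A B (i := i) (by simp [hex]) with h | h
    · exact h.trans hex
    · exact h
  have hj' : j ≠ Q.counterfeit → updateStatus Q A B j = CoinStatus.excluded := fun _ => by
    refine (updateStatus_eq_or_excluded Q A B hj).resolve_left fun hsame => hne ?_
    funext i
    by_cases hi : i = Q.counterfeit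
    · rw [hi, hc', hc]
    by_cases hij : i = j
    · rw [hij, hsame]
    · rw [hother' i hi hij, hother i hi hij]
  refine ⟨Finset.card_eq_one.mpr ⟨Q.counterfeit, ?_⟩, ?_⟩
  · ext i
    simp only [mem_nonExcluded, Finset.mem_singleton]
    refine ⟨fun h => ?_, fun h => ?_⟩
    · by_contra hi
      by_cases hij : i = j
      · subst hij
        exact h (hj' hi)
      · exact h (hother' i hi hij)
    · subst h
      exact hc'.trans_ne Q.fakeType.destiny_ne_excluded
  · exact hc'.trans_ne Q.fakeType.destiny_ne_unknown

/-- Weighing the unknown counterfeit coin against another unknown coin. -/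
theorem updateStatus_counterfeit_singleton {n : ℕ} {P : Position n} {j : Fin n}
    (hcf : P.status P.counterfeit = CoinStatus.unknown) (hj : j ≠ P.counterfeit)
    (hju : P.status j = CoinStatus.unknown) :
    updateStatus P {P.counterfeit} {j} P.counterfeit = P.fakeType.destiny ∧
    ((updateStatus P {P.counterfeit} {j} P.counterfeit = CoinStatus.light ∧
        updateStatus P {P.counterfeit} {j} j = CoinStatus.heavy) ∨
      (updateStatus P {P.counterfeit} {j} P.counterfeit = CoinStatus.heavy ∧
        updateStatus P {P.counterfeit} {j} j = CoinStatus.light)) ∧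
    ∀ i, i ≠ P.counterfeit → i ≠ j →
      updateStatus P {P.counterfeit} {j} i = CoinStatus.excluded := by
  cases hf : P.fakeType <;>
    simp +contextual [updateStatus, outcome, hf, hcf, hju, hj, hj.symm, FakeType.destiny,
      onLighterPan, onHeavierPan]

/-- For every `N ≥ 2`, in the misère-play unknown-coins
games with one extra genuine coin (`FM⁺_N` and `FIM⁺_N`), the first player
wins: weighing the counterfeit coin against one other unknown coin is a legal
weighing leaving exactly two non-excluded coins of opposite destinies (all
other coins being known genuine), a position from which every legal weighing
of the opponent completes the Observer's goal, so the opponent loses. -/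
theorem unknown_extra_misere_win {n N : ℕ} (P : Position n) (hN : 2 ≤ N)
    (hu : unknownCount P = N)
    (he : (statusSet P CoinStatus.excluded).card = 1)
    (hall : ∀ i, P.status i = CoinStatus.unknown ∨ P.status i = CoinStatus.excluded)
    (hcf : P.status P.counterfeit = CoinStatus.unknown) :
    (∀ j : Fin n, j ≠ P.counterfeit → P.status j = CoinStatus.unknown →
      GMove Found P (weigh P {P.counterfeit} {j}) ∧
      GMove FoundAndIdentified P (weigh P {P.counterfeit} {j}) ∧
      nonExcluded (weigh P {P.counterfeit} {j}) = {P.counterfeit, j} ∧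
      (((weigh P {P.counterfeit} {j}).status P.counterfeit = CoinStatus.light ∧
          (weigh P {P.counterfeit} {j}).status j = CoinStatus.heavy) ∨
       ((weigh P {P.counterfeit} {j}).status P.counterfeit = CoinStatus.heavy ∧
          (weigh P {P.counterfeit} {j}).status j = CoinStatus.light)) ∧
      (∀ R, GMove Found (weigh P {P.counterfeit} {j}) R → Found R) ∧
      (∀ R, GMove FoundAndIdentified (weigh P {P.counterfeit} {j}) R →
        FoundAndIdentified R)) ∧
    MisereWin (GMove Found) Found P ∧
    MisereWin (GMove FoundAndIdentified) FoundAndIdentified P := by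
  have hfirst : ∀ j : Fin n, j ≠ P.counterfeit → P.status j = CoinStatus.unknown →
      GMove Found P (weigh P {P.counterfeit} {j}) ∧
      GMove FoundAndIdentified P (weigh P {P.counterfeit} {j}) ∧
      nonExcluded (weigh P {P.counterfeit} {j}) = {P.counterfeit, j} ∧
      (((weigh P {P.counterfeit} {j}).status P.counterfeit = CoinStatus.light ∧
          (weigh P {P.counterfeit} {j}).status j = CoinStatus.heavy) ∨
       ((weigh P {P.counterfeit} {j}).status P.counterfeit = CoinStatus.heavy ∧
          (weigh P {P.counterfeit} {j}).status j = CoinStatus.light)) ∧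
      (∀ R, GMove Found (weigh P {P.counterfeit} {j}) R → Found R) ∧
      (∀ R, GMove FoundAndIdentified (weigh P {P.counterfeit} {j}) R →
        FoundAndIdentified R) := by
    intro j hj hju
    obtain ⟨hc, hopp, hother⟩ := updateStatus_counterfeit_singleton hcf hj hju
    have hnotFound : ¬ Found P := fun hP => by
      refine hj (Finset.card_le_one.mp hP.le j ?_ P.counterfeit ?_) <;>
        simp [mem_nonExcluded, hju, hcf]
    have hmove : Move P (weigh P {P.counterfeit} {j}) :=
      ⟨_, _, by simpa using hj.symm, by simp,
        fun h => P.fakeType.destiny_ne_unknown (by rw [← hc, h, hcf]), rfl⟩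
    have hjd : updateStatus P {P.counterfeit} {j} j ≠ CoinStatus.unknown ∧
        updateStatus P {P.counterfeit} {j} j ≠ CoinStatus.excluded := by
      rcases hopp with h | h <;> simp [h.2]
    have hreply : ∀ R, Move (weigh P {P.counterfeit} {j}) R → FoundAndIdentified R :=
      fun R => foundAndIdentified_of_move hc hjd.1 hother
    refine ⟨⟨hnotFound, hmove⟩, ⟨fun h => hnotFound h.1, hmove⟩, ?_, hopp,
      fun R hR => (hreply R hR.2).1, fun R hR => hreply R hR.2⟩
    ext i
    simp only [mem_nonExcluded, Finset.mem_insert, Finset.mem_singleton]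
    refine ⟨fun h => ?_, ?_⟩
    · by_contra! hi
      exact h (hother i hi.1 hi.2)
    · rintro (rfl | rfl)
      · exact hc.trans_ne P.fakeType.destiny_ne_excluded
      · exact hjd.2
  obtain ⟨j, hjmem, hj⟩ := Finset.exists_mem_ne
    (lt_of_lt_of_le one_lt_two (hN.trans hu.ge)) P.counterfeit
  obtain ⟨hF, hFI, hset, -, hRF, hRFI⟩ := hfirst j hj (by simpa [statusSet] using hjmem)
  have hnotFound : ¬ Found (weigh P {P.counterfeit} {j}) := by
    rw [Found, hset, Finset.card_pair hj.symm]
    decide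
  have hcx : P.status P.counterfeit ≠ CoinStatus.excluded := by simp [hcf]
  exact ⟨hfirst, misereWin_of_move hcx hF hnotFound hRF,
    misereWin_of_move hcx hFI (fun h => hnotFound h.1) hRFI⟩
end

section
/- For every odd N ≥ 3, the normal-play find-and-identify unknown-coins game without an extra coin satisfies G(FI_N) = 0; that is, the starting position with N unknown coins is a P-position (the first player loses under optimal play). -/
theorem mex_eq_zero_of_notMem {s : Set ℕ} (h : 0 ∉ s) : mex s = 0 :=
  Nat.sInf_eq_zero.2 (Or.inl h)

theorem mex_ne_zero_of_finite {s : Set ℕ} (hs : s.Finite) (h : 0 ∈ s) : mex s ≠ 0 := by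
  intro h0
  rcases Nat.sInf_eq_zero.1 h0 with h1 | h1
  · exact h1 h
  · obtain ⟨m, hm⟩ := hs.exists_notMem
    exact Set.eq_empty_iff_forall_notMem.1 h1 m hm

theorem grundyAux_eq_zero_of_goal {n : ℕ} {goal : Position n → Prop} {P : Position n}
    (h : goal P) (k : ℕ) : grundyAux (GMove goal) k P = 0 := by
  cases k with
  | zero => rfl
  | succ k =>
    refine mex_eq_zero_of_notMem ?_
    rintro ⟨Q, hQ, -⟩
    exact hQ.1 h

theorem grundyAux_succ_ne_zero {n : ℕ} {goal : Position n → Prop} {P Q : Position n} {k : ℕ}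
    (hPQ : GMove goal P Q) (hQ : grundyAux (GMove goal) k Q = 0) :
    grundyAux (GMove goal) (k + 1) P ≠ 0 := by
  refine mex_ne_zero_of_finite ?_ ⟨Q, hPQ, hQ⟩
  refine (Set.finite_range fun p : Finset (Fin n) × Finset (Fin n) =>
    grundyAux (GMove goal) k (weigh P p.1 p.2)).subset ?_
  rintro _ ⟨R, ⟨-, A, B, -, -, -, rfl⟩, rfl⟩
  exact ⟨(A, B), rfl⟩

/-- If an excluded coin is available, weighing the counterfeit against it reaches the goal. -/
theorem exists_gMove_foundAndIdentified {n : ℕ} {P : Position n}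
    (hgoal : ¬ FoundAndIdentified P)
    (hc : P.status P.counterfeit = CoinStatus.unknown ∨
      P.status P.counterfeit = P.fakeType.destiny)
    {e : Fin n} (he : P.status e = CoinStatus.excluded) :
    ∃ Q, GMove FoundAndIdentified P Q ∧ FoundAndIdentified Q := by
  have hne : P.counterfeit ≠ e := by
    rintro rfl
    cases hf : P.fakeType <;> simp [he, hf, FakeType.destiny] at hc
  have hstatus : ∀ i, updateStatus P {P.counterfeit} {e} i =
      if i = P.counterfeit then P.fakeType.destiny else CoinStatus.excluded := by
    intro i
    by_cases hi : i = P.counterfeit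
    · subst hi
      cases hf : P.fakeType <;> rcases hc with hc | hc <;>
        simp [updateStatus, outcome, hf, hc, hne, onLighterPan, onHeavierPan, FakeType.destiny]
    · by_cases hie : i = e
      · subst hie
        cases hf : P.fakeType <;>
          simp [updateStatus, outcome, hf, hi, he, onLighterPan, onHeavierPan]
      · cases hf : P.fakeType <;> simp [updateStatus, outcome, hf, hi, hie]
  have hR : FoundAndIdentified (weigh P {P.counterfeit} {e}) := by
    constructor
    · refine Finset.card_eq_one.2 ⟨P.counterfeit, ?_⟩
      ext i
      cases hf : P.fakeType <;> by_cases hi : i = P.counterfeit <;>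
        simp [nonExcluded, weigh, hstatus, hi, hf, FakeType.destiny]
    · cases hf : P.fakeType <;> simp [weigh, hstatus, hf, FakeType.destiny]
  refine ⟨_, ⟨hgoal, {P.counterfeit}, {e}, by simpa using hne, by simp, ?_, rfl⟩, hR⟩
  intro h
  apply hgoal
  have : weigh P {P.counterfeit} {e} = P := by
    unfold weigh
    rw [h]
  rwa [this] at hR

/-- The shape of a position reached by one weighing of an odd number of unknown coins. -/
theorem weigh_unknown_odd {n : ℕ} {P : Position n} (hn : Odd n)
    (hall : ∀ i, P.status i = CoinStatus.unknown) {A B : Finset (Fin n)}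
    (hdisj : Disjoint A B) (hcard : A.card = B.card) (hnew : updateStatus P A B ≠ P.status) :
    ¬ FoundAndIdentified (weigh P A B) ∧
      (updateStatus P A B P.counterfeit = CoinStatus.unknown ∨
        updateStatus P A B P.counterfeit = P.fakeType.destiny) ∧
      ∃ e, updateStatus P A B e = CoinStatus.excluded := by
  by_cases hc : P.counterfeit ∈ A ∨ P.counterfeit ∈ B
  · have hout : outcome P A B ≠ Outcome.balanced := by
      rcases hc with hc | hc <;> cases hf : P.fakeType <;> simp [outcome, hc, hf] <;>
        split <;> simp
    have hpan : ∀ i, i ∈ A ∨ i ∈ B → updateStatus P A B i ≠ CoinStatus.excluded := by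
      intro i hi
      cases ho : outcome P A B
      · exact absurd ho hout
      all_goals
        by_cases hA : i ∈ A <;> by_cases hB : i ∈ B <;>
          simp_all [updateStatus, onLighterPan, onHeavierPan]
    refine ⟨fun h => ?_, Or.inr ?_, ?_⟩
    · have hpos : 0 < A.card ∧ 0 < B.card := by
        rcases hc with hc | hc
        · have := Finset.card_pos.2 ⟨_, hc⟩
          omega
        · have := Finset.card_pos.2 ⟨_, hc⟩
          omega
      have hsub : A ∪ B ⊆ nonExcluded (weigh P A B) := by
        intro i hi
        exact Finset.mem_filter.2 ⟨Finset.mem_univ i, hpan i (Finset.mem_union.1 hi)⟩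
      have hle := Finset.card_le_card hsub
      rw [Finset.card_union_of_disjoint hdisj] at hle
      have h1 : (nonExcluded (weigh P A B)).card = 1 := h.1
      omega
    · by_cases hA : P.counterfeit ∈ A
      · have hB := Finset.disjoint_left.1 hdisj hA
        cases hf : P.fakeType <;>
          simp [updateStatus, outcome, hA, hB, hf, hall, onLighterPan, onHeavierPan,
            FakeType.destiny]
      · have hB := hc.resolve_left hA
        cases hf : P.fakeType <;>
          simp [updateStatus, outcome, hA, hB, hf, hall, onLighterPan, onHeavierPan,
            FakeType.destiny]
    · have hex : ∃ e, e ∉ A ∪ B := by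
        by_contra! hcon
        have huniv := congrArg Finset.card (Finset.eq_univ_iff_forall.2 hcon)
        rw [Finset.card_union_of_disjoint hdisj, Finset.card_univ, Fintype.card_fin] at huniv
        obtain ⟨m, hm⟩ := hn
        omega
      obtain ⟨e, he⟩ := hex
      rw [Finset.mem_union, not_or] at he
      refine ⟨e, ?_⟩
      cases ho : outcome P A B
      · exact absurd ho hout
      all_goals simp [updateStatus, ho, he.1, he.2]
  · rw [not_or] at hc
    have hout : outcome P A B = Outcome.balanced := by simp [outcome, hc.1, hc.2]
    have hcf : updateStatus P A B P.counterfeit = CoinStatus.unknown := by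
      simp [updateStatus, hout, hc.1, hc.2, hall]
    refine ⟨fun h => h.2 hcf, Or.inl hcf, ?_⟩
    obtain ⟨e, he⟩ := Function.ne_iff.1 hnew
    refine ⟨e, ?_⟩
    simp only [updateStatus, hout] at he ⊢
    split_ifs at he ⊢ with h
    · rfl
    · exact absurd rfl he

/-- For every odd `N ≥ 3`, the normal-play find-and-identify
unknown-coins game without an extra coin satisfies `G(FI_N) = 0`: the starting
position with `N` unknown coins is a P-position (the first player loses under
optimal play). -/
theorem grundy_unknown_odd_findIdentify {n : ℕ} (P : Position n)
    (hN : 3 ≤ n) (hn : Odd n)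
    (hall : ∀ i, P.status i = CoinStatus.unknown) :
    grundy (GMove FoundAndIdentified) P = 0 := by
  have hinfo : info P = 2 * n - 2 + 1 + 1 := by
    simp only [info, hall, statusWeight, Finset.sum_const, Finset.card_univ, Fintype.card_fin,
      smul_eq_mul]
    omega
  rw [grundy, hinfo]
  refine mex_eq_zero_of_notMem ?_
  rintro ⟨_, ⟨-, A, B, hdisj, hcard, hnew, rfl⟩, hQ⟩
  obtain ⟨hgoal, hc, e, he⟩ := weigh_unknown_odd hn hall hdisj hcard hnew
  obtain ⟨R, hQR, hR⟩ := exists_gMove_foundAndIdentified hgoal hc he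
  exact grundyAux_succ_ne_zero hQR (grundyAux_eq_zero_of_goal hR _) hQ
end
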